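/- arXiv:0905.0217 — 3 statements merged into one kernel-verified Lean document; each statement's English description precedes it below -/
import Mathlib

section
/- A nonzero finitely generated ideal I of a local integral domain D is a cancellation ideal if and only if I is principal. -/
theorem kap_aux {D : Type*} [CommRing D] [IsDomain D] [IsLocalRing D] (I A : Ideal D) (hI : I ≠ 0)
    (hc : ∀ G H : Ideal D, G ≠ 0 → H ≠ 0 → I * G = I * H → G = H) (x y : D)
    (hIA : I = Ideal.span {x} ⊔ Ideal.span {y} ⊔ A)
    (hM : IsLocalRing.maximalIdeal D * I ≤ A) :
    I = Ideal.span {x} ⊔ A ∨ I = Ideal.span {y} ⊔ A := by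
  have hc' : ∀ G H : Ideal D, H ≠ 0 → I * G = I * H → G = H := by
    intro G H hH h
    refine hc G H ?_ hH h
    rintro rfl
    rw [mul_zero] at h
    exact (mul_ne_zero hI hH) h.symm
  have hx : x ∈ I := by
    rw [hIA]; exact Ideal.mem_sup_left (Ideal.mem_sup_left (Ideal.mem_span_singleton_self x))
  have hy : y ∈ I := by
    rw [hIA]; exact Ideal.mem_sup_left (Ideal.mem_sup_right (Ideal.mem_span_singleton_self y))
  have hA : A ≤ I := by rw [hIA]; exact le_sup_right
  have hII : I * I = Ideal.span {x * x} ⊔ Ideal.span {y * y} ⊔ (Ideal.span {x * y} ⊔ I * A) := by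
    apply le_antisymm
    · have h1 : I * I = I * Ideal.span {x} ⊔ I * Ideal.span {y} ⊔ I * A := by
        rw [← Ideal.mul_sup, ← Ideal.mul_sup, ← hIA]
      have key : ∀ z : D, I * Ideal.span {z} =
          Ideal.span {x * z} ⊔ Ideal.span {y * z} ⊔ A * Ideal.span {z} := by
        intro z
        conv_lhs => rw [hIA]
        rw [Ideal.sup_mul, Ideal.sup_mul, Ideal.span_singleton_mul_span_singleton,
          Ideal.span_singleton_mul_span_singleton]
      have k2 : ∀ z ∈ I, A * Ideal.span {z} ≤ I * A := by
        intro z hz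
        rw [mul_comm]
        exact Ideal.mul_mono_left ((Ideal.span_singleton_le_iff_mem I).2 hz)
      have kx := k2 x hx
      have ky := k2 y hy
      rw [h1, key, key, mul_comm y x]
      refine sup_le (sup_le (sup_le (sup_le ?_ ?_) ?_) (sup_le (sup_le ?_ ?_) ?_)) ?_
      · exact le_sup_of_le_left le_sup_left
      · exact le_sup_of_le_right le_sup_left
      · exact le_sup_of_le_right (le_sup_of_le_right kx)
      · exact le_sup_of_le_right le_sup_left
      · exact le_sup_of_le_left le_sup_right
      · exact le_sup_of_le_right (le_sup_of_le_right ky)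
      · exact le_sup_of_le_right le_sup_right
    · refine sup_le (sup_le ?_ ?_) (sup_le ?_ (Ideal.mul_mono_right hA)) <;>
        rw [Ideal.span_singleton_le_iff_mem] <;> apply Ideal.mul_mem_mul <;> assumption
  set L := Ideal.span {x * y} ⊔ I * A with hL
  have hLI : L ≤ I * I := by rw [hII]; exact le_sup_right
  have hxy : x * y ∈ L := Ideal.mem_sup_left (Ideal.mem_span_singleton_self _)
  have hLA : I * A ≤ L := le_sup_right
  have hxx : x * x ∈ I * I := Ideal.mul_mem_mul hx hx
  have hyy : y * y ∈ I * I := Ideal.mul_mem_mul hy hy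
  have hI2 : I * I ≠ 0 := mul_ne_zero hI hI
  -- mixed cube terms
  have hJ : Ideal.span {x * x + y * y} ⊔ L = I * I := by
    apply hc' _ _ hI2
    apply le_antisymm
    · apply Ideal.mul_mono_right
      refine sup_le ?_ hLI
      rw [Ideal.span_singleton_le_iff_mem]
      exact add_mem hxx hyy
    · set J := Ideal.span {x * x + y * y} ⊔ L with hJ
      have hLJ : L ≤ J := le_sup_right
      have hs : x * x + y * y ∈ J := Ideal.mem_sup_left (Ideal.mem_span_singleton_self _)
      have hax : ∀ z ∈ I, ∀ w ∈ I, ∀ a ∈ A, a * (z * w) ∈ I * J := by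
        intro z hz w hw a ha
        have := Ideal.mul_mem_mul hz (hLJ (hLA (Ideal.mul_mem_mul hw ha)))
        convert this using 1; ring
      have h1 : ∀ z ∈ I, z * (x * y) ∈ I * J := fun z hz => Ideal.mul_mem_mul hz (hLJ hxy)
      have h2 : ∀ z ∈ I, z * (x * x + y * y) ∈ I * J := fun z hz => Ideal.mul_mem_mul hz hs
      have gen : ∀ w ∈ I, x * (w * w) ∈ I * J → y * (w * w) ∈ I * J →
          I * Ideal.span {w * w} ≤ I * J := by
        intro w hw hxw hyw
        conv_lhs => rw [hIA]
        rw [Ideal.sup_mul, Ideal.sup_mul, Ideal.span_singleton_mul_span_singleton,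
          Ideal.span_singleton_mul_span_singleton]
        refine sup_le (sup_le ?_ ?_) ?_
        · rwa [Ideal.span_singleton_le_iff_mem]
        · rwa [Ideal.span_singleton_le_iff_mem]
        · rw [Ideal.mul_le]
          intro a ha b hb
          obtain ⟨c, rfl⟩ := Ideal.mem_span_singleton'.1 hb
          rw [show a * (c * (w * w)) = c * (a * (w * w)) by ring]
          exact Ideal.mul_mem_left _ _ (hax w hw w hw a ha)
      rw [hII, Ideal.mul_sup, Ideal.mul_sup]
      refine sup_le (sup_le (gen x hx ?_ ?_) (gen y hy ?_ ?_)) (Ideal.mul_mono_right hLJ)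
      · convert sub_mem (h2 x hx) (h1 y hy) using 1; ring
      · convert h1 x hx using 1; ring
      · convert h1 y hy using 1; ring
      · convert sub_mem (h2 y hy) (h1 x hx) using 1; ring
  have fin : ∀ z ∈ I, ∀ w ∈ I, I = Ideal.span {z} ⊔ Ideal.span {w} ⊔ A →
      I * I = Ideal.span {z * z} ⊔ Ideal.span {w * w} ⊔ (Ideal.span {z * w} ⊔ I * A) →
      z * z ∈ I * (Ideal.span {w} ⊔ A) → I = Ideal.span {w} ⊔ A := by
    intro z hz w hw _ h2 h3
    symm
    apply hc' _ _ hI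
    have hwK : w ∈ Ideal.span {w} ⊔ A := Ideal.mem_sup_left (Ideal.mem_span_singleton_self _)
    apply le_antisymm
    · exact Ideal.mul_mono_right (sup_le ((Ideal.span_singleton_le_iff_mem I).2 hw) hA)
    · rw [h2]
      refine sup_le (sup_le ?_ ?_) (sup_le ?_ (Ideal.mul_mono_right le_sup_right))
      · rwa [Ideal.span_singleton_le_iff_mem]
      · rw [Ideal.span_singleton_le_iff_mem]; exact Ideal.mul_mem_mul hw hwK
      · rw [Ideal.span_singleton_le_iff_mem]; exact Ideal.mul_mem_mul hz hwK
  have hLx : L ≤ I * (Ideal.span {x} ⊔ A) := by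
    refine sup_le ?_ (Ideal.mul_mono_right le_sup_right)
    rw [Ideal.span_singleton_le_iff_mem, mul_comm x y]
    exact Ideal.mul_mem_mul hy (Ideal.mem_sup_left (Ideal.mem_span_singleton_self _))
  have hLy : L ≤ I * (Ideal.span {y} ⊔ A) := by
    refine sup_le ?_ (Ideal.mul_mono_right le_sup_right)
    rw [Ideal.span_singleton_le_iff_mem]
    exact Ideal.mul_mem_mul hx (Ideal.mem_sup_left (Ideal.mem_span_singleton_self _))
  rw [← hJ] at hxx
  obtain ⟨u, hu, l, hl, hul⟩ := Submodule.mem_sup.1 hxx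
  obtain ⟨t, rfl⟩ := Ideal.mem_span_singleton'.1 hu
  by_cases ht : IsUnit t
  · left
    refine fin y hy x hx (by rw [hIA, sup_comm (Ideal.span {x})]) ?_ ?_
    · rw [mul_comm y x, sup_comm (Ideal.span {y * y})]; exact hII
    · obtain ⟨s, hs⟩ := ht.exists_left_inv
      have hxK : x * x ∈ I * (Ideal.span {x} ⊔ A) :=
        Ideal.mul_mem_mul hx (Ideal.mem_sup_left (Ideal.mem_span_singleton_self _))
      have : y * y = s * ((1 - t) * (x * x) - l) := by
        linear_combination (-(y * y)) * hs + s * hul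
      rw [this]
      exact Ideal.mul_mem_left _ _ (sub_mem (Ideal.mul_mem_left _ _ hxK) (hLx hl))
  · right
    refine fin x hx y hy hIA hII (hLy ?_)
    have htM : t ∈ IsLocalRing.maximalIdeal D := ht
    have e : x * x = x * (t * x) + y * (t * y) + l := by rw [← hul]; ring
    rw [e]
    refine add_mem (add_mem ?_ ?_) hl
    · exact hLA (Ideal.mul_mem_mul hx (hM (Ideal.mul_mem_mul htM hx)))
    · exact hLA (Ideal.mul_mem_mul hy (hM (Ideal.mul_mem_mul htM hy)))

theorem kap_ind {D : Type*} [CommRing D] [IsDomain D] [IsLocalRing D] (I : Ideal D) (hI : I ≠ 0)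
    (hfg : I.FG)
    (hc : ∀ G H : Ideal D, G ≠ 0 → H ≠ 0 → I * G = I * H → G = H) (l : List D) :
    ∀ x : D, I = Ideal.span {x} ⊔ Ideal.span {d | d ∈ l} → I.IsPrincipal := by
  induction l with
  | nil => 
    intro x hx
    refine ⟨⟨x, ?_⟩⟩
    simpa using hx
  | cons y l ih =>
    intro x hx
    have e : Ideal.span {d | d ∈ y :: l} = Ideal.span {y} ⊔ Ideal.span {d | d ∈ l} := by
      rw [← Ideal.span_union]; congr 1; ext; simp
    rw [e, ← sup_assoc] at hx
    set B := Ideal.span {d | d ∈ l}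
    set M := IsLocalRing.maximalIdeal D
    have hMI : M * I ≤ I := Ideal.mul_le_right
    have nak : ∀ z, I = Ideal.span {z} ⊔ (B ⊔ M * I) → I.IsPrincipal := by
      intro z hz
      apply ih z
      apply le_antisymm
      · apply Submodule.le_of_le_smul_of_le_jacobson_bot (I := M) hfg
          (IsLocalRing.maximalIdeal_le_jacobson _)
        rw [smul_eq_mul, sup_assoc]
        exact hz.le
      · rw [hz, ← sup_assoc]; exact le_sup_left
    have := kap_aux I (B ⊔ M * I) hI hc x y
      (by rw [← sup_assoc, ← hx]; exact (sup_eq_left.2 hMI).symm) le_sup_right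
    rcases this with h | h
    · exact nak x h
    · exact nak y h

/-- Kaplansky: a nonzero finitely generated ideal of a local integral domain is a
cancellation ideal iff it is principal. -/
theorem cancellation_iff_principal_of_local (D : Type*) [CommRing D] [IsDomain D]
    [IsLocalRing D] (I : Ideal D) (hI : I ≠ 0) (hfg : I.FG) :
    (∀ G H : Ideal D, G ≠ 0 → H ≠ 0 → I * G = I * H → G = H) ↔ I.IsPrincipal := by
  constructor
  · intro hc
    obtain ⟨s, hs⟩ := hfg
    refine kap_ind I hI ⟨s, hs⟩ hc s.toList 0 ?_
    rw [← hs]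
    simp [Ideal.span]
  · rintro ⟨a, rfl⟩ G H _ _ h
    have ha : a ≠ 0 := by
      rintro rfl
      exact hI (by simp)
    exact (Ideal.span_singleton_mul_right_inj ha).1 h
end

section
/- For a nonzero ideal I of an integral domain D, I is a cancellation ideal if and only if I·D_M is a principal ideal of D_M for every maximal ideal M of D. -/
theorem canc_mem {D : Type*} [CommRing D] [IsDomain D] {I : Ideal D} (hI : I ≠ 0)
    (hc : ∀ G H : Ideal D, G ≠ 0 → H ≠ 0 → I * G = I * H → G = H)
    (K : Ideal D) (z : D) (h : ∀ i ∈ I, i * z ∈ I * K) : z ∈ K := by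
  by_cases hK : K = 0
  · obtain ⟨i, hi, hi0⟩ := Submodule.exists_mem_ne_zero_of_ne_bot hI
    have := h i hi
    rw [hK, mul_zero] at this
    have h0 : i * z = 0 := by simpa using this
    have : z = 0 := (mul_eq_zero.mp h0).resolve_left hi0
    rw [this]; exact K.zero_mem
  · have h1 : I * (K ⊔ Ideal.span {z}) = I * K := by
      rw [Ideal.mul_sup]
      refine sup_eq_left.mpr (Ideal.mul_le.mpr ?_)
      intro i hi w hw
      obtain ⟨r, rfl⟩ := Ideal.mem_span_singleton'.mp hw
      have := (I * K).mul_mem_left r (h i hi)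
      convert this using 1; ring
    have hK' : K ⊔ Ideal.span {z} ≠ 0 := by
      intro h0
      exact hK (le_bot_iff.mp (le_sup_left.trans (le_of_eq h0)))
    rw [← hc _ _ hK' hK h1]
    exact Ideal.mem_sup_right (Ideal.mem_span_singleton_self z)

theorem inv_mod {D : Type*} [CommRing D] {M : Ideal D} (hM : M.IsMaximal) {t : D}
    (ht : t ∉ M) : ∃ t' m : D, m ∈ M ∧ t' * t + m = 1 := by
  obtain ⟨y, i, hi, h⟩ := hM.exists_inv ht
  exact ⟨y, i, hi, h⟩

theorem hyperplane {D : Type*} [CommRing D] {M I : Ideal D} (hM : M.IsMaximal)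
    (x y : D) (hx : x ∉ Ideal.span {y} ⊔ M * I) :
    ∃ B : Ideal D, y ∈ B ∧ M * I ≤ B ∧ x ∉ B ∧ ∀ z ∈ I, ∃ r, z - r * x ∈ B := by
  obtain ⟨B, hB0, hB⟩ := zorn_le_nonempty₀ {B : Ideal D | x ∉ B} (by
    intro c hc hchain w hw
    refine ⟨sSup c, ?_, fun z hz => le_sSup hz⟩
    intro hxs
    obtain ⟨b, hb, hxb⟩ := (Submodule.mem_sSup_of_directed ⟨w, hw⟩ hchain.directedOn).mp hxs
    exact hc hb hxb) _ hx
  have hMB : M * I ≤ B := le_sup_right.trans hB0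
  refine ⟨B, hB0 (Ideal.mem_sup_left (Ideal.mem_span_singleton_self y)), hMB, hB.prop, ?_⟩
  intro z hz
  by_cases hzB : z ∈ B
  · exact ⟨0, by simpa using hzB⟩
  have hxz : x ∈ Ideal.span {z} ⊔ B := by
    by_contra hn
    have := hB.le_of_ge (y := Ideal.span {z} ⊔ B) hn le_sup_right
    exact hzB (this (Ideal.mem_sup_left (Ideal.mem_span_singleton_self z)))
  obtain ⟨r, b, hb, hrb⟩ := Ideal.mem_span_singleton_sup.mp hxz
  have hr : r ∉ M := by
    intro hr
    apply hB.prop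
    rw [← hrb]
    exact B.add_mem (hMB (Ideal.mul_mem_mul hr hz)) hb
  obtain ⟨t, m, hm, htm⟩ := inv_mod hM hr
  refine ⟨t, ?_⟩
  have h2 : z - t * x = m * z - t * b := by
    rw [← hrb]; linear_combination (-z) * htm
  rw [h2]
  exact B.sub_mem (hMB (Ideal.mul_mem_mul hm hz)) (B.mul_mem_left _ hb)

theorem two_gen {D : Type*} [CommRing D] [IsDomain D] {I : Ideal D} (hI : I ≠ 0)
    (hc : ∀ G H : Ideal D, G ≠ 0 → H ≠ 0 → I * G = I * H → G = H)
    {M : Ideal D} (hM : M.IsMaximal) (x y : D) (hx : x ∈ I) (hy : y ∈ I)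
    (A : Ideal D) (hMA : M * I ≤ A)
    (hgen : ∀ z ∈ I, ∃ r s a, a ∈ A ∧ z = r * x + s * y + a) :
    x ∈ Ideal.span {y} ⊔ A ∨ y ∈ Ideal.span {x} ⊔ A := by
  have key : x * x ∈ Ideal.span {x * x + y * y} ⊔ (Ideal.span {x * y} ⊔ I * A) := by
    set J := Ideal.span {x * x + y * y} ⊔ (Ideal.span {x * y} ⊔ I * A) with hJ
    have j1 : x * x + y * y ∈ J := Ideal.mem_sup_left (Ideal.mem_span_singleton_self _)
    have j2 : x * y ∈ J :=
      Ideal.mem_sup_right (Ideal.mem_sup_left (Ideal.mem_span_singleton_self _))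
    have j3 : I * A ≤ J := le_sup_right.trans le_sup_right
    apply canc_mem hI hc
    intro i hi
    obtain ⟨r, s, a, ha, rfl⟩ := hgen i hi
    have e : (r * x + s * y + a) * (x * x) = r * (x * (x * x + y * y)) + (-r) * (y * (x * y))
      + s * (x * (x * y)) + x * (x * a) := by ring
    rw [e]
    exact add_mem (add_mem (add_mem (Ideal.mul_mem_left _ _ (Ideal.mul_mem_mul hx j1))
      (Ideal.mul_mem_left _ _ (Ideal.mul_mem_mul hy j2)))
      (Ideal.mul_mem_left _ _ (Ideal.mul_mem_mul hx j2)))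
      (Ideal.mul_mem_mul hx (j3 (Ideal.mul_mem_mul hx ha)))
  obtain ⟨t, b, hb, h1⟩ := Ideal.mem_span_singleton_sup.mp key
  obtain ⟨s, w, hw, rfl⟩ := Ideal.mem_span_singleton_sup.mp hb
  by_cases ht : t ∈ M
  · left
    set K := Ideal.span {y} ⊔ A with hK
    have ky : y ∈ K := Ideal.mem_sup_left (Ideal.mem_span_singleton_self _)
    have kA : A ≤ K := le_sup_right
    have kw : w ∈ I * K := Ideal.mul_mono_right kA hw
    apply canc_mem hI hc
    intro i hi
    obtain ⟨p, q, a, ha, rfl⟩ := hgen i hi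
    have e : (p * x + q * y + a) * x = p * (x * (t * x)) + p * (y * (t * y))
        + (p * s + q) * (x * y) + p * w + x * a := by
      linear_combination (-p) * h1
    rw [e]
    exact add_mem (add_mem (add_mem (add_mem
      (Ideal.mul_mem_left _ _ (Ideal.mul_mem_mul hx (kA (hMA (Ideal.mul_mem_mul ht hx)))))
      (Ideal.mul_mem_left _ _ (Ideal.mul_mem_mul hy (kA (hMA (Ideal.mul_mem_mul ht hy))))))
      (Ideal.mul_mem_left _ _ (Ideal.mul_mem_mul hx ky)))
      (Ideal.mul_mem_left _ _ kw)) (Ideal.mul_mem_mul hx (kA ha))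
  · right
    obtain ⟨t', m, hm, htm⟩ := inv_mod hM ht
    set K := Ideal.span {x} ⊔ A with hK
    have kx : x ∈ K := Ideal.mem_sup_left (Ideal.mem_span_singleton_self _)
    have kA : A ≤ K := le_sup_right
    have kw : w ∈ I * K := Ideal.mul_mono_right kA hw
    apply canc_mem hI hc
    intro i hi
    obtain ⟨p, q, a, ha, rfl⟩ := hgen i hi
    have e : (p * x + q * y + a) * y = q * (y * (m * y)) + (q * t' * (1 - t)) * (x * x)
        + (p - q * t' * s) * (y * x) + (-q * t') * w + y * a := by
      linear_combination (q * t') * h1 - (q * y * y) * htm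
    rw [e]
    exact add_mem (add_mem (add_mem (add_mem
      (Ideal.mul_mem_left _ _ (Ideal.mul_mem_mul hy (kA (hMA (Ideal.mul_mem_mul hm hy)))))
      (Ideal.mul_mem_left _ _ (Ideal.mul_mem_mul hx kx)))
      (Ideal.mul_mem_left _ _ (Ideal.mul_mem_mul hy kx)))
      (Ideal.mul_mem_left _ _ kw)) (Ideal.mul_mem_mul hy (kA ha))

theorem one_gen {D : Type*} [CommRing D] [IsDomain D] {I : Ideal D} (hI : I ≠ 0)
    (hc : ∀ G H : Ideal D, G ≠ 0 → H ≠ 0 → I * G = I * H → G = H)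
    {M : Ideal D} (hM : M.IsMaximal) (x y : D) (hx : x ∈ I) (hxM : x ∉ M * I) (hy : y ∈ I) :
    y ∈ Ideal.span {x} ⊔ M * I := by
  by_contra hyn
  have hxn : x ∉ Ideal.span {y} ⊔ M * I := by
    intro h
    obtain ⟨r, b, hb, hrb⟩ := Ideal.mem_span_singleton_sup.mp h
    by_cases hr : r ∈ M
    · apply hxM
      rw [← hrb]
      exact add_mem (Ideal.mul_mem_mul hr hy) hb
    · obtain ⟨t, m, hm, htm⟩ := inv_mod hM hr
      apply hyn
      refine Ideal.mem_span_singleton_sup.mpr ⟨t, m * y - t * b, sub_mem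
        (Ideal.mul_mem_mul hm hy) (Ideal.mul_mem_left _ _ hb), ?_⟩
      rw [← hrb]; linear_combination y * htm
  obtain ⟨B, hyB, hMB, hxB, hB⟩ := hyperplane hM x y hxn
  obtain ⟨C, hxC, hMC, hyC, hC⟩ := hyperplane hM y x hyn
  rcases two_gen hI hc hM x y hx hy (B ⊓ C) (le_inf hMB hMC) (by
    intro z hz
    obtain ⟨r, hr⟩ := hB z hz
    obtain ⟨s, hs⟩ := hC (z - r * x) (sub_mem hz (I.mul_mem_left _ hx))
    exact ⟨r, s, z - r * x - s * y, ⟨sub_mem hr (B.mul_mem_left _ hyB), hs⟩, by ring⟩) with h | h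
  · exact hxB ((sup_le ((Ideal.span_singleton_le_iff_mem _).mpr hyB) inf_le_left) h)
  · exact hyC ((sup_le ((Ideal.span_singleton_le_iff_mem _).mpr hxC) inf_le_right) h)

/-- Anderson–Roitman: a nonzero ideal `I` of an integral domain is a cancellation
ideal iff `I·D_M` is principal for every maximal ideal `M`. -/
theorem cancellation_iff_locally_principal (D : Type*) [CommRing D] [IsDomain D]
    (I : Ideal D) (hI : I ≠ 0) :
    (∀ G H : Ideal D, G ≠ 0 → H ≠ 0 → I * G = I * H → G = H) ↔
    (∀ (M : Ideal D) (hM : M.IsMaximal),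
        haveI : M.IsPrime := hM.isPrime
        (I.map (algebraMap D (Localization.AtPrime M))).IsPrincipal) := by
  constructor
  · intro hc M hM
    haveI : M.IsPrime := hM.isPrime
    have hex : ∃ x ∈ I, x ∉ M * I := by
      by_contra! hn
      apply hM.ne_top
      rw [Ideal.eq_top_iff_one]
      apply canc_mem hI hc
      intro i hi
      rw [mul_one, mul_comm]
      exact hn i hi
    obtain ⟨x, hx, hxM⟩ := hex
    refine ⟨algebraMap D _ x, ?_⟩
    apply le_antisymm
    · refine Ideal.map_le_iff_le_comap.mpr ?_
      intro b hb
      have h1 : b ∈ Ideal.span {x} ⊔ M * Ideal.span {b} := by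
        apply canc_mem hI hc
        intro i hi
        obtain ⟨r, m, hm, rfl⟩ := Ideal.mem_span_singleton_sup.mp (one_gen hI hc hM x i hx hxM hi)
        have e : (r * x + m) * b = r * (b * x) + m * b := by ring
        rw [e]
        refine add_mem (Ideal.mul_mem_left _ _ (Ideal.mul_mem_mul hb
          (Ideal.mem_sup_left (Ideal.mem_span_singleton_self _)))) ?_
        have h2 : m * b ∈ M * I * Ideal.span {b} :=
          Ideal.mul_mem_mul hm (Ideal.mem_span_singleton_self _)
        rw [mul_comm M I, mul_assoc] at h2
        exact Ideal.mul_mono_right le_sup_right h2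
      obtain ⟨r, w, hw, h2⟩ := Ideal.mem_span_singleton_sup.mp h1
      obtain ⟨m, hm, rfl⟩ := Ideal.mem_mul_span_singleton.mp hw
      have hs : 1 - m ∈ M.primeCompl := by
        intro h
        apply hM.ne_top
        rw [Ideal.eq_top_iff_one]
        simpa using add_mem h hm
      have hu := IsLocalization.map_units (Localization.AtPrime M) (⟨1 - m, hs⟩ : M.primeCompl)
      have h3 : (1 - m) * b = r * x := by linear_combination -h2
      change algebraMap D (Localization.AtPrime M) b ∈ Ideal.span {algebraMap D _ x}
      rw [← Ideal.unit_mul_mem_iff_mem _ hu, ← map_mul, h3, map_mul]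
      exact Ideal.mul_mem_left _ _ (Ideal.mem_span_singleton_self _)
    · exact (Ideal.span_singleton_le_iff_mem _).mpr (Ideal.mem_map_of_mem _ hx)
  · intro h G H _ _ hGH
    refine Ideal.eq_of_localization_maximal (fun M hM => ?_)
    have hp : M.IsPrime := hM.isPrime
    obtain ⟨a, ha⟩ := h M hM
    have ha' : I.map (algebraMap D (Localization.AtPrime M)) = Ideal.span {a} := ha
    have hinj : Function.Injective (algebraMap D (Localization.AtPrime M)) :=
      IsLocalization.injective _ M.primeCompl_le_nonZeroDivisors
    have hdom : IsDomain (Localization.AtPrime M) :=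
      IsLocalization.isDomain_localization M.primeCompl_le_nonZeroDivisors
    have ha0 : a ≠ 0 := by
      rintro rfl
      apply hI
      rw [Ideal.span_singleton_eq_bot.mpr rfl] at ha'
      exact (Ideal.map_eq_bot_iff_of_injective hinj).mp ha'
    have h2 := congrArg (Ideal.map (algebraMap D (Localization.AtPrime M))) hGH
    rw [Ideal.map_mul, Ideal.map_mul, ha'] at h2
    exact (Ideal.span_singleton_mul_right_inj ha0).mp h2
end

section
/- Let E be a nonzero D-submodule of the quotient field K of an integral domain D. Then E is a cancellation module for D (EG = EH implies G = H for all nonzero D-submodules G, H of K) if and only if E·D_M is a principal D_M-submodule of K for every maximal ideal M of D. -/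
variable (D : Type*) [CommRing D] [IsDomain D]

/-- The localization `D_M` of `D` at a prime `M`, viewed as a `D`-submodule of the
quotient field `K`: it is the `D`-span of the inverses of the elements outside `M`,
i.e. the set of fractions `a/s` with `a ∈ D`, `s ∉ M`. -/
def locSubmodule (M : Ideal D) : Submodule D (FractionRing D) :=
  Submodule.span D {y : FractionRing D | ∃ s ∉ M, y * algebraMap D (FractionRing D) s = 1}

theorem aux_mull {D : Type*} [CommRing D] [IsDomain D]
    {A B C : Submodule D (FractionRing D)} (h : A ≤ B) : A * C ≤ B * C :=
  Submodule.mul_le.2 fun _ hm _ hn => Submodule.mul_mem_mul (h hm) hn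

theorem aux_mulr {D : Type*} [CommRing D] [IsDomain D]
    {A B C : Submodule D (FractionRing D)} (h : A ≤ B) : C * A ≤ C * B :=
  Submodule.mul_le.2 fun _ hm _ hn => Submodule.mul_mem_mul hm (h hn)

theorem aux_smul_mul {D : Type*} [CommRing D] [IsDomain D]
    (M : Ideal D) (A B : Submodule D (FractionRing D)) : (M • A) * B = M • (A * B) := by
  apply le_antisymm
  · rw [Submodule.mul_le]
    intro u hu b hb
    induction hu using Submodule.smul_induction_on' with
    | smul m hm a ha =>
      rw [smul_mul_assoc]
      exact Submodule.smul_mem_smul hm (Submodule.mul_mem_mul ha hb)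
    | add x _ y _ h1 h2 => rw [add_mul]; exact add_mem h1 h2
  · rw [Submodule.smul_le]
    intro m hm n hn
    induction hn using Submodule.mul_induction_on' with
    | mem_mul_mem a ha b hb =>
      rw [← smul_mul_assoc]
      exact Submodule.mul_mem_mul (Submodule.smul_mem_smul hm ha) hb
    | add x _ y _ h1 h2 => rw [smul_add]; exact add_mem h1 h2

open Submodule in
theorem aux_cancel {D : Type*} [CommRing D] [IsDomain D]
    (E : Submodule D (FractionRing D))
    (hc : ∀ G H : Submodule D (FractionRing D), G ≠ ⊥ → H ≠ ⊥ → E * G = E * H → G = H)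
    (z : FractionRing D) (G : Submodule D (FractionRing D)) (hG : G ≠ ⊥)
    (h : ∀ e ∈ E, z * e ∈ G * E) : z ∈ G := by
  have h1 : E * (G ⊔ span D {z}) = E * G := by
    apply le_antisymm
    · rw [Submodule.mul_sup]
      refine sup_le le_rfl ?_
      rw [Submodule.mul_le]
      intro e he n hn
      obtain ⟨d, rfl⟩ := Submodule.mem_span_singleton.1 hn
      rw [mul_comm E G, mul_comm e, smul_mul_assoc]
      exact Submodule.smul_mem _ _ (h e he)
    · exact aux_mulr le_sup_left
  have h2 := hc _ _ (fun hb => hG (le_bot_iff.1 (hb ▸ le_sup_left))) hG h1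
  rw [← h2]
  exact (le_sup_right : span D {z} ≤ _) (Submodule.mem_span_singleton_self z)

open Submodule in
theorem aux_hyper {D : Type*} [CommRing D] [IsDomain D]
    (M : Ideal D) (hM : M.IsMaximal)
    (E W : Submodule D (FractionRing D)) (hWE : W ≤ E) (hMW : M • E ≤ W)
    (x : FractionRing D) (hxE : x ∈ E) (hxW : x ∉ W) :
    ∃ A : Submodule D (FractionRing D), W ≤ A ∧ A ≤ E ∧ x ∉ A ∧ E ≤ span D {x} ⊔ A := by
  obtain ⟨A, hWA, hA⟩ := zorn_le_nonempty₀
    {A : Submodule D (FractionRing D) | A ≤ E ∧ x ∉ A} (by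
      intro c hcS hch y hy
      refine ⟨sSup c, ⟨sSup_le fun a ha => (hcS ha).1, ?_⟩, fun a ha => le_sSup ha⟩
      intro hx
      obtain ⟨a, ha, hxa⟩ := (Submodule.mem_sSup_of_directed ⟨y, hy⟩ hch.directedOn).1 hx
      exact (hcS ha).2 hxa) W ⟨hWE, hxW⟩
  refine ⟨A, hWA, hA.1.1, hA.1.2, ?_⟩
  intro y hy
  by_cases hyA : y ∈ A
  · exact (le_sup_right : A ≤ _) hyA
  have hx : x ∈ A ⊔ span D {y} := by
    by_contra hx
    have := hA.2 (y := A ⊔ span D {y}) ⟨sup_le hA.1.1 (by simpa using hy), hx⟩ le_sup_left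
    exact hyA (this ((le_sup_right : span D {y} ≤ _) (mem_span_singleton_self y)))
  obtain ⟨a, ha, u, hu, hau⟩ := Submodule.mem_sup.1 hx
  obtain ⟨d, rfl⟩ := mem_span_singleton.1 hu
  by_cases hd : d ∈ M
  · exact absurd (hau ▸ A.add_mem ha (hWA (hMW (smul_mem_smul hd hy)))) hA.1.2
  obtain ⟨s, m, hm, hsm⟩ := hM.exists_inv hd
  have : y = s • x + (m • y - s • a) := by
    rw [← hau, smul_add, smul_smul]
    have : y = (s * d + m) • y := by rw [hsm, one_smul]
    rw [add_smul] at this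
    nth_rewrite 1 [this]
    abel
  rw [this]
  exact Submodule.add_mem_sup (smul_mem _ _ (mem_span_singleton_self x))
    (A.sub_mem (hWA (hMW (smul_mem_smul hm hy))) (A.smul_mem _ ha))

open Submodule in
theorem aux_exchange {D : Type*} [CommRing D] [IsDomain D]
    (E : Submodule D (FractionRing D))
    (hc : ∀ G H : Submodule D (FractionRing D), G ≠ ⊥ → H ≠ ⊥ → E * G = E * H → G = H)
    (M : Ideal D) (hM : M.IsMaximal)
    (A : Submodule D (FractionRing D)) (hAE : A ≤ E) (hMA : M • E ≤ A)
    (x y : FractionRing D) (hx : x ∈ E) (hy : y ∈ E) (hx0 : x ≠ 0) (hy0 : y ≠ 0)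
    (hE : ∀ e ∈ E, ∃ α β : D, ∃ a ∈ A, e = α • x + β • y + a) :
    x ∈ span D {y} ⊔ A ∨ y ∈ span D {x} ⊔ A := by
  have hne : ∀ (G : Submodule D (FractionRing D)) (v : FractionRing D), v ∈ G → v ≠ 0 → G ≠ ⊥ :=
    fun G v hv h0 hb => h0 (by simpa [hb] using hv)
  have key : ∀ (v : FractionRing D) (G : Submodule D (FractionRing D)), G ≠ ⊥ →
      v * x ∈ G * E → v * y ∈ G * E → (∀ a ∈ A, v * a ∈ G * E) → v ∈ G := by
    intro v G hG h1 h2 h3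
    refine aux_cancel E hc v G hG fun e he => ?_
    obtain ⟨α, β, a, ha, rfl⟩ := hE e he
    rw [mul_add, mul_add, mul_smul_comm, mul_smul_comm]
    exact add_mem (add_mem (smul_mem _ _ h1) (smul_mem _ _ h2)) (h3 a ha)
  have hxx : x * x ∈ span D {x * x + y * y} ⊔ (span D {x * y} ⊔ E * A) := by
    set J := span D {x * x + y * y} ⊔ (span D {x * y} ⊔ E * A) with hJ
    have j1 : x * x + y * y ∈ J :=
      (le_sup_left : _ ≤ J) (mem_span_singleton_self _)
    have j2 : x * y ∈ J :=
      (le_sup_right : _ ≤ J) ((le_sup_left : span D {x * y} ≤ _) (mem_span_singleton_self _))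
    have j3 : E * A ≤ J := le_trans le_sup_right (le_sup_right : _ ≤ J)
    refine key _ J (hne J _ j2 (mul_ne_zero hx0 hy0)) ?_ ?_ ?_
    · have : x * x * x = (x * x + y * y) * x - (x * y) * y := by ring
      rw [this]
      exact sub_mem (mul_mem_mul j1 hx) (mul_mem_mul j2 hy)
    · have : x * x * y = (x * y) * x := by ring
      rw [this]
      exact mul_mem_mul j2 hx
    · intro a ha
      have : x * x * a = (x * a) * x := by ring
      rw [this]
      exact mul_mem_mul (j3 (mul_mem_mul hx ha)) hx
  obtain ⟨u, hu, v, hv, huv⟩ := mem_sup.1 hxx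
  obtain ⟨p, hp, w, hw, rfl⟩ := mem_sup.1 hv
  obtain ⟨t, rfl⟩ := mem_span_singleton.1 hu
  obtain ⟨s, rfl⟩ := mem_span_singleton.1 hp
  by_cases ht : t ∈ M
  · left
    set G := span D {y} ⊔ A with hG
    have g1 : y ∈ G := (le_sup_left : _ ≤ G) (mem_span_singleton_self _)
    have g2 : A ≤ G := le_sup_right
    have g3 : E * A ≤ G * E := by rw [mul_comm E A]; exact aux_mull g2
    have gt : ∀ e ∈ E, t • e ∈ G := fun e he => g2 (hMA (smul_mem_smul ht he))
    have gxy : x * y ∈ G * E := by rw [mul_comm x]; exact mul_mem_mul g1 hx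
    refine key _ G (hne G _ g1 hy0) ?_ gxy ?_
    · have : x * x = (t • x) * x + (t • y) * y + s • (x * y) + w := by
        rw [smul_mul_assoc, smul_mul_assoc, ← smul_add, add_assoc, huv]
      rw [this]
      exact add_mem (add_mem (add_mem (mul_mem_mul (gt x hx) hx) (mul_mem_mul (gt y hy) hy))
        (smul_mem _ _ gxy)) (g3 hw)
    · intro a ha
      exact g3 (mul_mem_mul hx ha)
  · right
    set G := span D {x} ⊔ A with hG
    have g1 : x ∈ G := (le_sup_left : _ ≤ G) (mem_span_singleton_self _)
    have g2 : A ≤ G := le_sup_right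
    have g3 : E * A ≤ G * E := by rw [mul_comm E A]; exact aux_mull g2
    have gxy : x * y ∈ G * E := mul_mem_mul g1 hy
    have gxx : x * x ∈ G * E := mul_mem_mul g1 hx
    refine key _ G (hne G _ g1 hx0) (by rw [mul_comm y]; exact gxy) ?_ ?_
    · obtain ⟨r, m, hm, hrm⟩ := hM.exists_inv ht
      have h1 : t • (y * y) ∈ G * E := by
        have : t • (y * y) = x * x - t • (x * x) - s • (x * y) - w := by
          nth_rewrite 1 [← huv]
          rw [smul_add]
          abel
        rw [this]
        exact sub_mem (sub_mem (sub_mem gxx (smul_mem _ _ gxx)) (smul_mem _ _ gxy)) (g3 hw)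
      have h2 : y * y = r • (t • (y * y)) + (m • y) * y := by
        rw [smul_smul, smul_mul_assoc, ← add_smul, hrm, one_smul]
      rw [h2]
      exact add_mem (smul_mem _ _ h1) (mul_mem_mul (g2 (hMA (smul_mem_smul hm hy))) hy)
    · intro a ha
      exact g3 (mul_mem_mul hy ha)

open Submodule in
theorem aux_gen {D : Type*} [CommRing D] [IsDomain D]
    (E : Submodule D (FractionRing D)) (hE : E ≠ ⊥)
    (hc : ∀ G H : Submodule D (FractionRing D), G ≠ ⊥ → H ≠ ⊥ → E * G = E * H → G = H)
    (M : Ideal D) (hM : M.IsMaximal) :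
    ∃ x ∈ E, x ∉ M • E ∧ E ≤ span D {x} ⊔ M • E := by
  have hMEle : M • E ≤ E := Submodule.smul_le_right
  have hlt : ¬ E ≤ M • E := by
    intro hle
    by_cases hM0 : M = ⊥
    · subst hM0
      exact hE (le_bot_iff.1 (by simpa using hle))
    · have h1 : (1 : FractionRing D) ∈ M • (1 : Submodule D (FractionRing D)) := by
        refine aux_cancel E hc _ _ ?_ ?_
        · intro hb
          apply hM0
          rw [eq_bot_iff]
          intro m hm
          have : m • (1 : FractionRing D) ∈ M • (1 : Submodule D (FractionRing D)) :=
            smul_mem_smul hm (Submodule.mem_one.2 ⟨1, map_one _⟩)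
          rw [hb, mem_bot, Algebra.smul_def, mul_one] at this
          exact (mem_bot D).2 ((FaithfulSMul.algebraMap_eq_zero_iff D (FractionRing D)).1 this)
        · intro e he
          rw [one_mul, aux_smul_mul, one_mul]
          exact hle he
      have h2 : M • (1 : Submodule D (FractionRing D)) ≤ Submodule.map (Algebra.linearMap D (FractionRing D)) M := by
        rw [Submodule.smul_le]
        rintro m hm n hn
        obtain ⟨d, rfl⟩ := Submodule.mem_one.1 hn
        exact ⟨m * d, M.mul_mem_right _ hm, by simp [Algebra.smul_def]⟩
      obtain ⟨m, hm, hm1⟩ := h2 h1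
      have : m = 1 := by
        apply FaithfulSMul.algebraMap_injective D (FractionRing D)
        simpa using hm1
      exact hM.ne_top ((Ideal.eq_top_iff_one M).2 (this ▸ hm))
  obtain ⟨x, hxE, hxM⟩ := Set.not_subset.1 hlt
  obtain ⟨A, hWA, hAE, hxA, hEA⟩ := aux_hyper M hM E (M • E) hMEle le_rfl x hxE hxM
  refine ⟨x, hxE, hxM, ?_⟩
  suffices A ≤ M • E from hEA.trans (sup_le_sup_left this _)
  by_contra hAM
  obtain ⟨y, hyA, hyM⟩ := Set.not_subset.1 hAM
  have hyE : y ∈ E := hAE hyA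
  have hMA : M • A ≤ M • E := Submodule.smul_mono le_rfl hAE
  obtain ⟨B, hWB, hBA, hyB, hAB⟩ := aux_hyper M hM A (M • E) hWA hMA y hyA hyM
  have hx0 : x ≠ 0 := fun h => hxM (h ▸ zero_mem _)
  have hy0 : y ≠ 0 := fun h => hyM (h ▸ zero_mem _)
  rcases aux_exchange E hc M hM B (hBA.trans hAE) hWB x y hxE hyE hx0 hy0 (by
    intro e he
    obtain ⟨u, hu, a, ha, rfl⟩ := mem_sup.1 (hEA he)
    obtain ⟨α, rfl⟩ := mem_span_singleton.1 hu
    obtain ⟨v, hv, b, hb, rfl⟩ := mem_sup.1 (hAB ha)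
    obtain ⟨β, rfl⟩ := mem_span_singleton.1 hv
    exact ⟨α, β, b, hb, by rw [add_assoc]⟩) with h | h
  · have : span D {y} ⊔ B ≤ A := sup_le (by simpa using hyA) hBA
    exact hxA (this h)
  · obtain ⟨u, hu, b, hb, hub⟩ := mem_sup.1 h
    obtain ⟨d, rfl⟩ := mem_span_singleton.1 hu
    by_cases hd : d ∈ M
    · exact hyB (hub ▸ B.add_mem (hWB (smul_mem_smul hd hxE)) hb)
    · obtain ⟨s, m, hm, hsm⟩ := hM.exists_inv hd
      have hdx : d • x ∈ A := by
        have : d • x = y - b := by rw [← hub]; abel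
        rw [this]
        exact A.sub_mem hyA (hBA hb)
      apply hxA
      have : x = s • (d • x) + m • x := by rw [smul_smul, ← add_smul, hsm, one_smul]
      rw [this]
      exact A.add_mem (A.smul_mem _ hdx) (hWA (smul_mem_smul hm hxE))

open Submodule in
theorem aux_loc {D : Type*} [CommRing D] [IsDomain D]
    (M : Ideal D) (hM : M.IsMaximal) (H : Submodule D (FractionRing D))
    (g : FractionRing D) (hg : g ∈ H * locSubmodule D M) : ∃ s ∉ M, s • g ∈ H := by
  have hp := hM.isPrime
  have h1M : (1 : D) ∉ M := fun h => hM.ne_top ((Ideal.eq_top_iff_one M).2 h)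
  have hadd : ∀ a b : FractionRing D, (∃ s ∉ M, s • a ∈ H) → (∃ s ∉ M, s • b ∈ H) →
      ∃ s ∉ M, s • (a + b) ∈ H := by
    rintro a b ⟨s, hs, hsa⟩ ⟨t, ht, htb⟩
    refine ⟨s * t, fun h => (hp.mem_or_mem h).elim hs ht, ?_⟩
    rw [smul_add]
    refine H.add_mem ?_ ?_
    · rw [mul_comm, mul_smul]; exact H.smul_mem _ hsa
    · rw [mul_smul]; exact H.smul_mem _ htb
  refine Submodule.mul_induction_on hg ?_ hadd
  intro h hh l hl
  unfold locSubmodule at hl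
  induction hl using Submodule.span_induction with
  | mem y hy =>
    obtain ⟨s, hs, hys⟩ := hy
    refine ⟨s, hs, ?_⟩
    have : s • (h * y) = h := by
      rw [Algebra.smul_def]
      calc _ = h * (y * algebraMap D (FractionRing D) s) := by ring
        _ = h := by rw [hys, mul_one]
    rwa [this]
  | zero => exact ⟨1, h1M, by simp⟩
  | add a b _ _ ha hb => rw [mul_add]; exact hadd _ _ ha hb
  | smul d a _ ha =>
    obtain ⟨s, hs, hsa⟩ := ha
    refine ⟨s, hs, ?_⟩
    rw [mul_smul_comm, smul_comm]
    exact H.smul_mem _ hsa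

/-- Goeters–Olberding: a nonzero `D`-submodule `E` of the quotient field `K` is a
cancellation module for `D` iff `E·D_M` is a principal `D_M`-submodule of `K` for
every maximal ideal `M` of `D`. -/
theorem cancellation_module_iff_locally_principal
    (E : Submodule D (FractionRing D)) (hE : E ≠ ⊥) :
    (∀ G H : Submodule D (FractionRing D), G ≠ ⊥ → H ≠ ⊥ → E * G = E * H → G = H) ↔
    (∀ M : Ideal D, M.IsMaximal →
        ∃ x : FractionRing D,
          E * locSubmodule D M = Submodule.span D {x} * locSubmodule D M) := by
  have hone : ∀ M : Ideal D, M.IsMaximal → (1 : FractionRing D) ∈ locSubmodule D M := by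
    intro M hM
    exact Submodule.subset_span ⟨1, fun h => hM.ne_top ((Ideal.eq_top_iff_one M).2 h), by simp⟩
  constructor
  · intro hc M hM
    obtain ⟨x, hxE, hxM, hEx⟩ := aux_gen E hE hc M hM
    have hx0 : x ≠ 0 := fun h => hxM (h ▸ zero_mem _)
    refine ⟨x, le_antisymm ?_ (aux_mull (by simpa using hxE))⟩
    have hz : ∀ z ∈ E, ∃ s ∉ M, s • z ∈ Submodule.span D {x} := by
      intro z hz
      have hmem : z ∈ Submodule.span D {x} ⊔ M • Submodule.span D {z} := by
        set G := Submodule.span D {x} ⊔ M • Submodule.span D {z} with hG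
        have g1 : x ∈ G := (le_sup_left : _ ≤ G) (Submodule.mem_span_singleton_self _)
        refine aux_cancel E hc z G (fun hb => hx0 (by simpa [hb] using g1)) ?_
        intro e he
        obtain ⟨u, hu, w, hw, rfl⟩ := Submodule.mem_sup.1 (hEx he)
        obtain ⟨α, rfl⟩ := Submodule.mem_span_singleton.1 hu
        rw [mul_add, mul_smul_comm]
        refine add_mem (Submodule.smul_mem _ _ ?_) ?_
        · rw [mul_comm z]; exact Submodule.mul_mem_mul g1 hz
        · have h1 : z * w ∈ Submodule.span D {z} * (M • E) :=
            Submodule.mul_mem_mul (Submodule.mem_span_singleton_self _) hw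
          rw [mul_comm, aux_smul_mul, mul_comm E, ← aux_smul_mul] at h1
          exact aux_mull (le_sup_right : _ ≤ G) h1
      obtain ⟨u, hu, w, hw, huw⟩ := Submodule.mem_sup.1 hmem
      obtain ⟨m, hm, rfl⟩ := Submodule.mem_smul_span_singleton.1 hw
      refine ⟨1 - m, ?_, ?_⟩
      · intro h
        exact hM.ne_top ((Ideal.eq_top_iff_one M).2 (by simpa using M.add_mem h hm))
      · have : (1 - m) • z = u := by
          rw [sub_smul, one_smul, sub_eq_iff_eq_add, huw]
        rwa [this]
    have hLL : locSubmodule D M * locSubmodule D M ≤ locSubmodule D M := by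
      unfold locSubmodule
      rw [Submodule.span_mul_span]
      refine Submodule.span_mono ?_
      rintro _ ⟨a, ⟨s, hs, has⟩, b, ⟨t, ht, hbt⟩, rfl⟩
      refine ⟨s * t, fun h => (hM.isPrime.mem_or_mem h).elim hs ht, ?_⟩
      simp only [map_mul]
      rw [mul_mul_mul_comm, has, hbt, one_mul]
    have hEle : E ≤ Submodule.span D {x} * locSubmodule D M := by
      intro z hzE
      obtain ⟨s, hs, hsz⟩ := hz z hzE
      have hs0 : algebraMap D (FractionRing D) s ≠ 0 := by
        intro h
        rw [FaithfulSMul.algebraMap_eq_zero_iff] at h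
        exact hs (h ▸ M.zero_mem)
      have : z = (s • z) * (algebraMap D (FractionRing D) s)⁻¹ := by
        rw [Algebra.smul_def]; field_simp
      rw [this]
      exact Submodule.mul_mem_mul hsz
        (Submodule.subset_span ⟨s, hs, inv_mul_cancel₀ hs0⟩)
    calc E * locSubmodule D M
        ≤ (Submodule.span D {x} * locSubmodule D M) * locSubmodule D M :=
          aux_mull hEle
      _ = Submodule.span D {x} * (locSubmodule D M * locSubmodule D M) := mul_assoc _ _ _
      _ ≤ _ := aux_mulr hLL
  · intro hloc
    have main : ∀ G H : Submodule D (FractionRing D), E * G = E * H → G ≤ H := by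
      intro G H hGH g hg
      let I : Ideal D := H.comap (LinearMap.toSpanSingleton D (FractionRing D) g)
      have hI : I = ⊤ := by
        by_contra hI
        obtain ⟨M, hM, hIM⟩ := Ideal.exists_le_maximal I hI
        obtain ⟨x, hx⟩ := hloc M hM
        have hx0 : x ≠ 0 := by
          rintro rfl
          apply hE
          rw [eq_bot_iff]
          intro e he
          have h1 : e * 1 ∈ E * locSubmodule D M := Submodule.mul_mem_mul he (hone M hM)
          rw [hx] at h1
          simpa using h1
        have hGL : G * locSubmodule D M = H * locSubmodule D M := by
          have h1 : Submodule.span D {x} * (G * locSubmodule D M)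
              = Submodule.span D {x} * (H * locSubmodule D M) := by
            rw [mul_left_comm, ← hx, mul_left_comm, ← mul_assoc, hGH, mul_assoc,
              mul_left_comm, hx, mul_left_comm]
          have h2 : Submodule.span D {x⁻¹} * Submodule.span D {x} = 1 := by
            rw [Submodule.span_mul_span, Set.singleton_mul_singleton, inv_mul_cancel₀ hx0,
              Submodule.one_eq_span]
          have h3 := congrArg (fun N => Submodule.span D {x⁻¹} * N) h1
          simpa only [← mul_assoc, h2, one_mul] using h3
        have hgL : g * 1 ∈ H * locSubmodule D M := by
          rw [← hGL]
          exact Submodule.mul_mem_mul hg (hone M hM)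
        rw [mul_one] at hgL
        obtain ⟨s, hs, hsg⟩ := aux_loc M hM H g hgL
        exact hs (hIM (by simpa [I] using hsg))
      have : (1 : D) ∈ I := hI ▸ Submodule.mem_top
      simpa [I] using this
    intro G H _ _ hGH
    exact le_antisymm (main G H hGH) (main H G hGH.symm)
end
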